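/- Let n, d, N ≥ 1 be integers and let f : ℝ^d → ℝ be n times continuously differentiable on a neighborhood of [0,1]^d with |∂^α f(x)| ≤ 1 for every multi-index α with |α| ≤ n and every x ∈ [0,1]^d. Then the localized Taylor approximant f₁ satisfies |f(x) − f₁(x)| ≤ (2^d d^n / n!) · N^{−n} for every x ∈ [0,1]^d. -/

import Mathlib

open scoped BigOperators

noncomputable section

/-- The piecewise-linear bump function `ψ`. -/
def psi (x : ℝ) : ℝ :=
  if |x| ≤ 1 then 1 else if |x| ≤ 2 then 2 - |x| else 0

/-- The partition-of-unity factor `φ_m(x) = ∏_{k=1}^d ψ(3N(x_k − m_k/N))`. -/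
def phi (d N : ℕ) (m : Fin d → ℕ) (x : Fin d → ℝ) : ℝ :=
  ∏ k, psi (3 * (N : ℝ) * (x k - (m k : ℝ) / (N : ℝ)))

/-- The partial derivative in the `i`-th coordinate direction. -/
def partialDeriv {d : ℕ} (i : Fin d) (f : (Fin d → ℝ) → ℝ) : (Fin d → ℝ) → ℝ :=
  fun x => fderiv ℝ f x (Pi.single i 1)

/-- The multi-index partial derivative `∂^α f`. -/
def multiDeriv {d : ℕ} (α : Fin d → ℕ) (f : (Fin d → ℝ) → ℝ) : (Fin d → ℝ) → ℝ :=
  (List.finRange d).foldr (fun i g => (partialDeriv i)^[α i] g) f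

/-- `P_m`, the Taylor polynomial of `f` of degree `n−1` at the point `m/N`:
`P_m(x) = ∑_{|α| ≤ n−1} (∂^α f(m/N)/α!) (x − m/N)^α`. -/
def taylorP (d n N : ℕ) (f : (Fin d → ℝ) → ℝ) (m : Fin d → ℕ) (x : Fin d → ℝ) : ℝ :=
  ∑ α ∈ Finset.univ.filter (fun α : Fin d → Fin n => (∑ i, (α i : ℕ)) ≤ n - 1),
    (multiDeriv (fun i => (α i : ℕ)) f (fun i => (m i : ℝ) / (N : ℝ))
        / ∏ i, ((α i : ℕ).factorial : ℝ))
      * ∏ i, (x i - (m i : ℝ) / (N : ℝ)) ^ (α i : ℕ)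

/-- The localized Taylor approximant `f₁ = ∑_{m ∈ {0,…,N}^d} φ_m · P_m`. -/
def f1 (d n N : ℕ) (f : (Fin d → ℝ) → ℝ) (x : Fin d → ℝ) : ℝ :=
  ∑ m : Fin d → Fin (N + 1),
    phi d N (fun k => (m k : ℕ)) x * taylorP d n N f (fun k => (m k : ℕ)) x

theorem psi_nonneg (x : ℝ) : 0 ≤ psi x := by
  unfold psi
  split_ifs <;> linarith

theorem psi_ne_zero {x : ℝ} (h : psi x ≠ 0) : |x| ≤ 2 := by
  unfold psi at h
  split_ifs at h with h1 h2
  · linarith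
  · exact h2
  · exact absurd rfl h

theorem psi_eq (x : ℝ) : psi x = max 0 (min 1 (2 - |x|)) := by
  unfold psi
  split_ifs with h1 h2
  · rw [min_eq_left (by linarith), max_eq_right (by norm_num)]
  · rw [min_eq_right (by linarith), max_eq_right (by linarith)]
  · rw [max_eq_left]
    exact (min_le_right _ _).trans (by linarith)

theorem psi_sum (N : ℕ) (s : ℝ) (hs : 0 ≤ s) :
    ∑ j ∈ Finset.range (N + 1), psi (s - 3 * (j : ℝ)) = max 0 (min 1 (3 * (N : ℝ) + 2 - s)) := by
  induction N with
  | zero => simp [psi_eq, abs_of_nonneg hs]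
  | succ k ih =>
    rw [Finset.sum_range_succ, ih, psi_eq]
    push_cast
    have hk : (0 : ℝ) ≤ k := Nat.cast_nonneg k
    generalize (k : ℝ) = q at *
    rcases abs_cases (s - 3 * (q + 1)) with ⟨h, h'⟩ | ⟨h, h'⟩ <;> rw [h]
    · rw [max_eq_left (a := (0 : ℝ)) (b := min 1 (3 * q + 2 - s))
        ((min_le_right _ _).trans (by linarith)), zero_add]
      congr 2
      ring
    · rw [min_eq_left (a := (1 : ℝ)) (b := 3 * (q + 1) + 2 - s) (by linarith)]
      rcases le_total 1 (3 * q + 2 - s) with h1 | h1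
      · rw [min_eq_left h1, max_eq_left (a := (0 : ℝ)) (b := min 1 _)
          ((min_le_right _ _).trans (by linarith))]
        simp
      · rw [min_eq_right h1]
        rcases le_total 0 (3 * q + 2 - s) with h2 | h2
        · rw [max_eq_right h2, min_eq_right (by linarith), max_eq_right (by linarith),
            max_eq_right (by linarith)]
          ring
        · rw [max_eq_left h2, min_eq_left (by linarith), zero_add]

theorem phi_nonneg (d N : ℕ) (m : Fin d → ℕ) (x : Fin d → ℝ) : 0 ≤ phi d N m x :=
  Finset.prod_nonneg fun _ _ => psi_nonneg _

theorem phi_sum (d N : ℕ) (hN : 1 ≤ N) (x : Fin d → ℝ) (hx : x ∈ Set.Icc (0 : Fin d → ℝ) 1) :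
    ∑ m : Fin d → Fin (N + 1), phi d N (fun k => (m k : ℕ)) x = 1 := by
  have hN' : (1 : ℝ) ≤ N := by exact_mod_cast hN
  have h := Finset.prod_univ_sum (fun _ : Fin d => (Finset.univ : Finset (Fin (N + 1))))
    (fun k j => psi (3 * (N : ℝ) * (x k - ((j : ℕ) : ℝ) / (N : ℝ))))
  simp only [Fintype.piFinset_univ] at h
  unfold phi
  rw [← h]
  apply Finset.prod_eq_one
  intro k _
  have h0 : 0 ≤ x k := hx.1 k
  have h1 : x k ≤ 1 := hx.2 k
  have h2 := psi_sum N (3 * N * x k) (by positivity)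
  rw [Finset.sum_range] at h2
  have h3 : ∀ j : Fin (N + 1), 3 * (N : ℝ) * (x k - ((j : ℕ) : ℝ) / (N : ℝ))
      = 3 * N * x k - 3 * ((j : ℕ) : ℝ) := by
    intro j
    field_simp
  simp only [h3]
  rw [h2, min_eq_left, max_eq_right] <;> nlinarith

theorem pd_congr {d : ℕ} {U : Set (Fin d → ℝ)} (hU : IsOpen U) (i : Fin d)
    {f g : (Fin d → ℝ) → ℝ} (h : Set.EqOn f g U) :
    Set.EqOn (partialDeriv i f) (partialDeriv i g) U := by
  intro x hx
  unfold partialDeriv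
  rw [(h.eventuallyEq_of_mem (hU.mem_nhds hx)).fderiv_eq]

theorem pd_iter_congr {d : ℕ} {U : Set (Fin d → ℝ)} (hU : IsOpen U) (i : Fin d) (k : ℕ)
    {f g : (Fin d → ℝ) → ℝ} (h : Set.EqOn f g U) :
    Set.EqOn ((partialDeriv i)^[k] f) ((partialDeriv i)^[k] g) U := by
  induction k with
  | zero => exact h
  | succ k ih =>
    rw [Function.iterate_succ_apply', Function.iterate_succ_apply']
    exact pd_congr hU i ih

theorem pd_contDiff {d : ℕ} {U : Set (Fin d → ℝ)} (hU : IsOpen U) (i : Fin d) (m : ℕ)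
    {f : (Fin d → ℝ) → ℝ} (h : ContDiffOn ℝ ((m + 1 : ℕ)) f U) :
    ContDiffOn ℝ m (partialDeriv i f) U := by
  unfold partialDeriv
  exact (h.fderiv_of_isOpen hU (by push_cast; exact le_rfl)).clm_apply contDiffOn_const

theorem pd_iter_contDiff {d : ℕ} {U : Set (Fin d → ℝ)} (hU : IsOpen U) (i : Fin d) (k m : ℕ)
    {f : (Fin d → ℝ) → ℝ} (h : ContDiffOn ℝ ((m + k : ℕ)) f U) :
    ContDiffOn ℝ m ((partialDeriv i)^[k] f) U := by
  induction k generalizing m with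
  | zero => exact h
  | succ k ih =>
    rw [Function.iterate_succ_apply']
    apply pd_contDiff hU
    apply ih
    convert h using 2
    push_cast
    ring

theorem pd_comm {d : ℕ} {U : Set (Fin d → ℝ)} (hU : IsOpen U) (i j : Fin d)
    {f : (Fin d → ℝ) → ℝ} (h : ContDiffOn ℝ 2 f U) :
    Set.EqOn (partialDeriv i (partialDeriv j f)) (partialDeriv j (partialDeriv i f)) U := by
  intro x hx
  have hs : IsSymmSndFDerivAt ℝ f x :=
    (h.contDiffAt (hU.mem_nhds hx)).isSymmSndFDerivAt (by simp)
  have hd : DifferentiableAt ℝ (fderiv ℝ f) x :=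
    ((h.fderiv_of_isOpen hU (m := 1) (by norm_num)).differentiableOn
      (by norm_num)).differentiableAt (hU.mem_nhds hx)
  have key : ∀ v w : Fin d → ℝ, fderiv ℝ (fun y => fderiv ℝ f y v) x w
      = fderiv ℝ (fderiv ℝ f) x w v := by
    intro v w
    rw [fderiv_clm_apply hd (differentiableAt_const v)]
    simp
  unfold partialDeriv
  rw [key, key]
  exact hs _ _

theorem pd_comm_iter {d : ℕ} {U : Set (Fin d → ℝ)} (hU : IsOpen U) (i j : Fin d) (k : ℕ)
    {f : (Fin d → ℝ) → ℝ} (h : ContDiffOn ℝ ((k + 1 : ℕ)) f U) :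
    Set.EqOn (partialDeriv i ((partialDeriv j)^[k] f)) ((partialDeriv j)^[k] (partialDeriv i f))
      U := by
  induction k with
  | zero => exact fun x _ => rfl
  | succ k ih =>
    rw [Function.iterate_succ_apply', Function.iterate_succ_apply']
    refine (pd_comm hU i j ?_).trans (pd_congr hU j (ih (h.of_le ?_)))
    · apply pd_iter_contDiff hU j k 2
      convert h using 2
      push_cast
      ring
    · exact_mod_cast Nat.le_succ _

/-- derivative along a list of coordinates -/
def lD {d : ℕ} (α : Fin d → ℕ) (l : List (Fin d)) (f : (Fin d → ℝ) → ℝ) : (Fin d → ℝ) → ℝ :=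
  l.foldr (fun i g => (partialDeriv i)^[α i] g) f

theorem lD_contDiff {d : ℕ} {U : Set (Fin d → ℝ)} (hU : IsOpen U) (α : Fin d → ℕ)
    (l : List (Fin d)) (m : ℕ)
    {f : (Fin d → ℝ) → ℝ} (h : ContDiffOn ℝ ((m + (l.map α).sum : ℕ)) f U) :
    ContDiffOn ℝ m (lD α l f) U := by
  induction l generalizing m with
  | nil => simpa [lD] using h
  | cons j l ih =>
    apply pd_iter_contDiff hU j (α j) m
    apply ih
    convert h using 2
    simp [add_assoc]

theorem lD_notMem {d : ℕ} (α : Fin d → ℕ) (i : Fin d) (l : List (Fin d)) (hi : i ∉ l)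
    (f : (Fin d → ℝ) → ℝ) : lD (α + Pi.single i 1) l f = lD α l f := by
  induction l with
  | nil => rfl
  | cons j l ih =>
    simp only [List.mem_cons, not_or] at hi
    have := ih hi.2
    simp only [lD, List.foldr_cons] at this ⊢
    rw [this]
    simp [Pi.single_apply, Ne.symm hi.1]

theorem pd_lD {d : ℕ} {U : Set (Fin d → ℝ)} (hU : IsOpen U) (α : Fin d → ℕ) (i : Fin d)
    (l : List (Fin d)) (hl : l.Nodup) (hi : i ∈ l)
    {f : (Fin d → ℝ) → ℝ} (h : ContDiffOn ℝ (((l.map α).sum + 1 : ℕ)) f U) :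
    Set.EqOn (partialDeriv i (lD α l f)) (lD (α + Pi.single i 1) l f) U := by
  induction l with
  | nil => simp at hi
  | cons j l ih =>
    rw [List.nodup_cons] at hl
    have e1 : ∀ β : Fin d → ℕ, lD β (j :: l) f = (partialDeriv j)^[β j] (lD β l f) :=
      fun β => rfl
    rw [e1, e1]
    by_cases hij : i = j
    · subst hij
      rw [lD_notMem α i l hl.1]
      simp only [Pi.add_apply, Pi.single_eq_same]
      rw [Function.iterate_succ_apply']
      exact fun x _ => rfl
    · have hi' : i ∈ l := by simpa [hij] using hi
      have e2 : (α + Pi.single i 1 : Fin d → ℕ) j = α j := by simp [Pi.single_apply, Ne.symm hij]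
      rw [e2]
      refine (pd_comm_iter hU i j (α j) ?_).trans (pd_iter_congr hU j _ (ih hl.2 hi' ?_))
      · apply lD_contDiff hU
        convert h using 2
        simp only [List.map_cons, List.sum_cons]
        push_cast
        ring
      · refine h.of_le ?_
        simp only [List.map_cons, List.sum_cons]
        exact_mod_cast (by omega)

theorem finRange_sum {d : ℕ} (α : Fin d → ℕ) : ((List.finRange d).map α).sum = ∑ i, α i := by
  rw [Fin.sum_univ_def]

theorem mD_contDiff {d : ℕ} {U : Set (Fin d → ℝ)} (hU : IsOpen U) (α : Fin d → ℕ) (m : ℕ)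
    {f : (Fin d → ℝ) → ℝ} (h : ContDiffOn ℝ ((m + ∑ i, α i : ℕ)) f U) :
    ContDiffOn ℝ m (multiDeriv α f) U := by
  rw [← finRange_sum] at h
  exact lD_contDiff hU α _ m h

theorem pd_mD {d : ℕ} {U : Set (Fin d → ℝ)} (hU : IsOpen U) (α : Fin d → ℕ) (i : Fin d)
    {f : (Fin d → ℝ) → ℝ} (h : ContDiffOn ℝ ((∑ i, α i + 1 : ℕ)) f U) :
    Set.EqOn (partialDeriv i (multiDeriv α f)) (multiDeriv (α + Pi.single i 1) f) U := by
  rw [← finRange_sum] at h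
  exact pd_lD hU α i _ (List.nodup_finRange d) (List.mem_finRange i) h

/-- homogeneous Taylor term -/
def tT (d k : ℕ) (f : (Fin d → ℝ) → ℝ) (h y : Fin d → ℝ) : ℝ :=
  ∑ α ∈ Finset.piAntidiag (Finset.univ : Finset (Fin d)) k,
    multiDeriv α f y / (∏ i, ((α i).factorial : ℝ)) * ∏ i, h i ^ α i

theorem reindex (d k : ℕ) (h : Fin d → ℝ) (D : (Fin d → ℕ) → ℝ) :
    ∑ α ∈ Finset.piAntidiag (Finset.univ : Finset (Fin d)) k,
      (∑ i, h i * D (α + Pi.single i 1)) / (∏ i, ((α i).factorial : ℝ)) * ∏ i, h i ^ α i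
    = ((k : ℝ) + 1) * ∑ α ∈ Finset.piAntidiag (Finset.univ : Finset (Fin d)) (k + 1),
      D α / (∏ i, ((α i).factorial : ℝ)) * ∏ i, h i ^ α i := by
  have h1 : ((k : ℝ) + 1) * ∑ α ∈ Finset.piAntidiag (Finset.univ : Finset (Fin d)) (k + 1),
      D α / (∏ i, ((α i).factorial : ℝ)) * ∏ i, h i ^ α i
      = ∑ i, ∑ α ∈ Finset.piAntidiag (Finset.univ : Finset (Fin d)) (k + 1),
      (α i : ℝ) * (D α / (∏ i, ((α i).factorial : ℝ)) * ∏ i, h i ^ α i) := by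
    rw [Finset.sum_comm, Finset.mul_sum]
    apply Finset.sum_congr rfl
    intro α hα
    rw [Finset.mem_piAntidiag] at hα
    rw [← Finset.sum_mul, ← Nat.cast_sum, hα.1]
    push_cast
    rfl
  rw [h1]
  simp only [Finset.sum_div, Finset.sum_mul]
  rw [Finset.sum_comm]
  apply Finset.sum_congr rfl
  intro i _
  apply Finset.sum_of_injOn (fun α => α + Pi.single i 1)
  · intro a _ b _ hab
    exact add_right_cancel hab
  · intro α hα
    simp only [Finset.mem_coe, Finset.mem_piAntidiag] at hα ⊢
    refine ⟨?_, by simp⟩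
    simp [Finset.sum_add_distrib, hα.1]
  · intro β hβ hn
    have : β i = 0 := by
      by_contra hne
      apply hn
      have hle : Pi.single i 1 ≤ β := by
        intro j
        by_cases hj : j = i
        · subst hj; simp; omega
        · simp [Pi.single_apply, hj]
      refine ⟨β - Pi.single i 1, ?_, tsub_add_cancel_of_le hle⟩
      simp only [Finset.mem_coe, Finset.mem_piAntidiag] at hβ ⊢
      refine ⟨?_, by simp⟩
      have h2 := hβ.1
      rw [← tsub_add_cancel_of_le hle] at h2
      simp only [Pi.add_apply, Finset.sum_add_distrib, Finset.sum_pi_single', Finset.mem_univ,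
        if_true] at h2
      exact Nat.succ_injective h2
    simp [this]
  · intro α _
    have e1 : ∏ j, h j ^ (α + Pi.single i 1 : Fin d → ℕ) j = h i * ∏ j, h j ^ α j := by
      simp only [Pi.add_apply, pow_add, Finset.prod_mul_distrib]
      rw [mul_comm]
      congr 1
      rw [Finset.prod_eq_single i] <;> simp +contextual [Pi.single_apply]
    have e2 : ∏ j, (((α + Pi.single i 1 : Fin d → ℕ) j).factorial : ℝ)
        = ((α i : ℝ) + 1) * ∏ j, ((α j).factorial : ℝ) := by
      have : ∀ j, (((α + Pi.single i 1 : Fin d → ℕ) j).factorial : ℝ)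
          = (if j = i then (α i : ℝ) + 1 else 1) * ((α j).factorial : ℝ) := by
        intro j
        by_cases hj : j = i
        · subst hj; simp [Nat.factorial_succ]
        · simp [Pi.single_apply, hj]
      simp only [this, Finset.prod_mul_distrib]
      simp
    rw [e1, e2]
    have e3 : (∏ j, ((α j).factorial : ℝ)) ≠ 0 :=
      Finset.prod_ne_zero_iff.2 fun j _ => by positivity
    have e4 : (α i : ℝ) + 1 ≠ 0 := by positivity
    simp only [Pi.add_apply, Pi.single_eq_same]
    push_cast
    field_simp

theorem tT_hasDeriv {n d : ℕ} {U : Set (Fin d → ℝ)} (hU : IsOpen U)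
    {f : (Fin d → ℝ) → ℝ} (hf : ContDiffOn ℝ n f U) (a h : Fin d → ℝ) (k : ℕ) (hk : k < n)
    (t : ℝ) (ht : a + t • h ∈ U) :
    HasDerivAt (fun s : ℝ => tT d k f h (a + s • h))
      (((k : ℝ) + 1) * tT d (k + 1) f h (a + t • h)) t := by
  unfold tT
  rw [← reindex d k h (fun α => multiDeriv α f (a + t • h))]
  apply HasDerivAt.fun_sum
  intro α hα
  apply HasDerivAt.mul_const
  apply HasDerivAt.div_const
  rw [Finset.mem_piAntidiag] at hα
  have hc : ContDiffOn ℝ ((∑ i, α i + 1 : ℕ)) f U :=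
    hf.of_le (by rw [hα.1]; exact_mod_cast hk)
  have hc1 : ContDiffOn ℝ (1 : ℕ) (multiDeriv α f) U := by
    apply mD_contDiff hU
    rwa [add_comm]
  have hd : HasFDerivAt (multiDeriv α f) (fderiv ℝ (multiDeriv α f) (a + t • h)) (a + t • h) :=
    ((hc1.differentiableOn (by norm_num)).differentiableAt (hU.mem_nhds ht)).hasFDerivAt
  have hl : HasDerivAt (fun s : ℝ => a + s • h) h t := by
    simpa using ((hasDerivAt_id t).smul_const h).const_add a
  have := hd.comp_hasDerivAt t hl
  refine HasDerivAt.congr_deriv this ?_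
  have hsum : fderiv ℝ (multiDeriv α f) (a + t • h) h
      = ∑ i, fderiv ℝ (multiDeriv α f) (a + t • h) (Pi.single i (h i)) := by
    rw [← map_sum, Finset.univ_sum_single]
  rw [hsum]
  symm
  apply Finset.sum_congr rfl
  intro i _
  rw [← pd_mD hU α i hc ht]
  have : (Pi.single i (h i) : Fin d → ℝ) = h i • Pi.single i (1 : ℝ) := by
    rw [← Pi.single_smul]; simp
  rw [this, map_smul]
  rfl

theorem tT_bound {n d : ℕ} (f : (Fin d → ℝ) → ℝ) (h y : Fin d → ℝ) (δ : ℝ)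
    (hh : ∀ i, |h i| ≤ δ)
    (hb : ∀ α : Fin d → ℕ, (∑ i, α i) ≤ n → |multiDeriv α f y| ≤ 1) :
    |tT d n f h y| ≤ (d * δ) ^ n / n.factorial := by
  have h1 : (∑ i, |h i|) ^ n / n.factorial ≤ (d * δ) ^ n / n.factorial := by
    have : ∑ i, |h i| ≤ d * δ := by
      simpa using Finset.sum_le_sum (s := Finset.univ) (fun i _ => hh i)
    have h0 : 0 ≤ ∑ i, |h i| := Finset.sum_nonneg fun i _ => abs_nonneg _
    gcongr
  refine le_trans ?_ h1
  rw [Finset.sum_pow_eq_sum_piAntidiag, Finset.sum_div]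
  refine (Finset.abs_sum_le_sum_abs _ _).trans (Finset.sum_le_sum ?_)
  intro α hα
  rw [Finset.mem_piAntidiag] at hα
  have hm := Nat.multinomial_spec Finset.univ α
  rw [hα.1] at hm
  have hm' : (n.factorial : ℝ) = (∏ i, ((α i).factorial : ℝ)) * Nat.multinomial Finset.univ α := by
    rw [← hm]; push_cast; rfl
  have hp : 0 < ∏ i, ((α i).factorial : ℝ) := Finset.prod_pos fun j _ => by positivity
  have hn : (0 : ℝ) < n.factorial := by positivity
  rw [abs_mul, abs_div, abs_of_pos hp, Finset.abs_prod]
  simp only [abs_pow]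
  have hmm : (Nat.multinomial Finset.univ α : ℝ) / n.factorial = 1 / ∏ i, ((α i).factorial : ℝ) := by
    rw [div_eq_div_iff hn.ne' hp.ne', hm']; ring
  rw [mul_div_right_comm, hmm]
  have := hb α hα.1.le
  gcongr

theorem taylor_main {n d : ℕ} (hn : 1 ≤ n) {U : Set (Fin d → ℝ)} (hU : IsOpen U)
    {f : (Fin d → ℝ) → ℝ} (hf : ContDiffOn ℝ n f U) (a h : Fin d → ℝ) (M : ℝ)
    (hseg : ∀ t ∈ Set.Icc (0 : ℝ) 1, a + t • h ∈ U)
    (hM : ∀ t ∈ Set.Icc (0 : ℝ) 1, |tT d n f h (a + t • h)| ≤ M) :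
    |f (a + h) - ∑ k ∈ Finset.range n, tT d k f h a| ≤ M := by
  set F : ℝ → ℝ := fun t => ∑ k ∈ Finset.range n, (1 - t) ^ k * tT d k f h (a + t • h) with hF
  have key : ∀ m, m ≤ n → ∀ t, a + t • h ∈ U → HasDerivAt
      (fun t => ∑ k ∈ Finset.range m, (1 - t) ^ k * tT d k f h (a + t • h))
      (m * (1 - t) ^ (m - 1) * tT d m f h (a + t • h)) t := by
    intro m
    induction m with
    | zero => intro _ t _; simpa using hasDerivAt_const t (0 : ℝ)
    | succ m ih =>
      intro hm t ht
      simp only [Finset.sum_range_succ]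
      have h1 := ih (by omega) t ht
      have h2 := tT_hasDeriv hU hf a h m (by omega) t ht
      have h3 : HasDerivAt (fun t : ℝ => (1 - t) ^ m) (m * (1 - t) ^ (m - 1) * (-1)) t :=
        ((hasDerivAt_id t).const_sub 1).pow m
      refine HasDerivAt.congr_deriv (h1.add (h3.mul h2)) ?_
      push_cast
      ring
  have hFd : ∀ t ∈ Set.Icc (0 : ℝ) 1, HasDerivAt F
      (n * (1 - t) ^ (n - 1) * tT d n f h (a + t • h)) t :=
    fun t ht => key n le_rfl t (hseg t ht)
  have hB : ∀ t : ℝ, HasDerivAt (fun t : ℝ => M * (1 - (1 - t) ^ n))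
      (M * (n * (1 - t) ^ (n - 1))) t := by
    intro t
    have := ((((hasDerivAt_id t).const_sub 1).pow n).const_sub 1).const_mul M
    refine HasDerivAt.congr_deriv this ?_
    simp only [id]
    ring
  have hfin := image_norm_le_of_norm_deriv_right_le_deriv_boundary'
    (f := fun t => F t - F 0) (a := 0) (b := 1)
    (f' := fun t => n * (1 - t) ^ (n - 1) * tT d n f h (a + t • h))
    (B := fun t : ℝ => M * (1 - (1 - t) ^ n)) (B' := fun t => M * (n * (1 - t) ^ (n - 1)))
    (fun t ht => ((hFd t ht).sub_const _).continuousAt.continuousWithinAt)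
    (fun t ht => ((hFd t ⟨ht.1, ht.2.le⟩).sub_const _).hasDerivWithinAt)
    (by simp)
    (fun t ht => (hB t).continuousAt.continuousWithinAt)
    (fun t ht => (hB t).hasDerivWithinAt)
    (by
      intro t ht
      have h1 := hM t ⟨ht.1, ht.2.le⟩
      have h2 : 0 ≤ 1 - t := by linarith [ht.2]
      rw [Real.norm_eq_abs, abs_mul, abs_of_nonneg (by positivity), mul_comm M]
      gcongr)
    (x := 1) (by simp)
  have hF0 : F 0 = ∑ k ∈ Finset.range n, tT d k f h a := by simp [hF]
  have hF1 : F 1 = f (a + h) := by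
    obtain ⟨m, rfl⟩ := Nat.exists_eq_add_of_le' hn
    simp only [hF, Finset.sum_range_succ']
    simp [tT, multiDeriv]
  rw [← hF0, ← hF1]
  simpa [Nat.pos_iff_ne_zero.1 hn] using hfin

theorem taylorP_eq (d n N : ℕ) (hn : 1 ≤ n) (f : (Fin d → ℝ) → ℝ) (m : Fin d → ℕ)
    (x : Fin d → ℝ) :
    taylorP d n N f m x = ∑ k ∈ Finset.range n,
      tT d k f (fun i => x i - (m i : ℝ) / (N : ℝ)) (fun i => (m i : ℝ) / (N : ℝ)) := by
  unfold taylorP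
  rw [← Finset.sum_fiberwise_of_maps_to (t := Finset.range n)
    (g := fun α : Fin d → Fin n => ∑ i, (α i : ℕ))]
  · apply Finset.sum_congr rfl
    intro k hk
    rw [Finset.mem_range] at hk
    unfold tT
    apply Finset.sum_bij (fun α _ => fun i => (α i : ℕ))
    · intro α hα
      simp only [Finset.mem_filter] at hα
      simp [Finset.mem_piAntidiag, hα.2]
    · intro α _ β _ hab
      funext i
      exact Fin.ext (congrFun hab i)
    · intro β hβ
      rw [Finset.mem_piAntidiag] at hβ
      have hlt : ∀ i, β i < n := fun i =>
        lt_of_le_of_lt (Finset.single_le_sum (f := β) (fun _ _ => Nat.zero_le _)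
          (Finset.mem_univ i)) (by rw [hβ.1]; exact hk)
      refine ⟨fun i => ⟨β i, hlt i⟩, ?_, rfl⟩
      have := hβ.1
      simp only [Finset.mem_filter, Finset.mem_univ, true_and]
      change Finset.univ.sum β ≤ n - 1 ∧ Finset.univ.sum β = k
      omega
    · intro α _
      rfl
  · intro α hα
    simp only [Finset.mem_filter, Finset.mem_univ, true_and] at hα
    simp only [Finset.mem_range]
    omega

/-- Let `n, d, N ≥ 1` and let `f : ℝ^d → ℝ` be `n` times continuously differentiable
on a neighborhood of `[0,1]^d` with `|∂^α f(x)| ≤ 1` for all `|α| ≤ n` and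
`x ∈ [0,1]^d`. Then `|f(x) − f₁(x)| ≤ (2^d d^n / n!) · N^{−n}` on `[0,1]^d`. -/
theorem localized_taylor_approx (n d N : ℕ) (hn : 1 ≤ n) (hd : 1 ≤ d) (hN : 1 ≤ N)
    (f : (Fin d → ℝ) → ℝ)
    (U : Set (Fin d → ℝ)) (hUopen : IsOpen U)
    (hUsub : Set.Icc (0 : Fin d → ℝ) 1 ⊆ U)
    (hf : ContDiffOn ℝ n f U)
    (hbound : ∀ α : Fin d → ℕ, (∑ i, α i) ≤ n →
      ∀ x ∈ Set.Icc (0 : Fin d → ℝ) 1, |multiDeriv α f x| ≤ 1) :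
    ∀ x ∈ Set.Icc (0 : Fin d → ℝ) 1,
      |f x - f1 d n N f x| ≤
        (2 : ℝ) ^ d * (d : ℝ) ^ n / (n.factorial : ℝ) * (1 / (N : ℝ) ^ n) := by
  intro x hx
  have hN' : (0 : ℝ) < N := by exact_mod_cast hN
  set C : ℝ := (d * (1 / (N : ℝ))) ^ n / n.factorial with hC
  have hC0 : 0 ≤ C := by positivity
  have hloc : ∀ m : Fin d → Fin (N + 1), phi d N (fun k => (m k : ℕ)) x ≠ 0 →
      |f x - taylorP d n N f (fun k => (m k : ℕ)) x| ≤ C := by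
    intro m hm
    have hh : ∀ i, |x i - ((m i : ℕ) : ℝ) / (N : ℝ)| ≤ 1 / N := by
      intro i
      have h1 := psi_ne_zero ((Finset.prod_ne_zero_iff.1 hm) i (Finset.mem_univ i))
      rw [abs_mul, abs_of_pos (by positivity)] at h1
      rw [le_div_iff₀ hN']
      nlinarith [abs_nonneg (x i - ((m i : ℕ) : ℝ) / (N : ℝ))]
    rw [taylorP_eq d n N hn]
    set a : Fin d → ℝ := fun i => ((m i : ℕ) : ℝ) / (N : ℝ) with ha
    set h : Fin d → ℝ := fun i => x i - ((m i : ℕ) : ℝ) / (N : ℝ) with hhd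
    have hx' : a + h = x := by funext i; simp [ha, hhd]
    have haI : a ∈ Set.Icc (0 : Fin d → ℝ) 1 := by
      constructor
      · intro i; simp only [ha, Pi.zero_apply]; positivity
      · intro i
        simp only [ha, Pi.one_apply]
        rw [div_le_one hN']
        exact_mod_cast Nat.lt_succ_iff.1 (m i).2
    have hseg : ∀ t ∈ Set.Icc (0 : ℝ) 1, a + t • h ∈ Set.Icc (0 : Fin d → ℝ) 1 := by
      intro t ht
      have : h = x - a := rfl
      rw [this]
      exact (convex_Icc (0 : Fin d → ℝ) 1).add_smul_sub_mem haI hx ht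
    have := taylor_main hn hUopen hf a h C (fun t ht => hUsub (hseg t ht))
      (fun t ht => tT_bound f h _ _ hh (fun α hα => hbound α hα _ (hseg t ht)))
    rwa [hx'] at this
  have hs := phi_sum d N hN x hx
  have e : f x - f1 d n N f x = ∑ m : Fin d → Fin (N + 1),
      phi d N (fun k => (m k : ℕ)) x * (f x - taylorP d n N f (fun k => (m k : ℕ)) x) := by
    simp only [mul_sub, Finset.sum_sub_distrib, ← Finset.sum_mul, hs, one_mul]
    rfl
  have hmain : |f x - f1 d n N f x| ≤ C := by
    rw [e]
    calc _ ≤ ∑ m : Fin d → Fin (N + 1), phi d N (fun k => (m k : ℕ)) x * C := by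
            refine (Finset.abs_sum_le_sum_abs _ _).trans (Finset.sum_le_sum ?_)
            intro m _
            have hp := phi_nonneg d N (fun k => (m k : ℕ)) x
            rw [abs_mul, abs_of_nonneg hp]
            by_cases h0 : phi d N (fun k => (m k : ℕ)) x = 0
            · simp [h0]
            · exact mul_le_mul_of_nonneg_left (hloc m h0) hp
      _ = C := by rw [← Finset.sum_mul, hs, one_mul]
  refine hmain.trans ?_
  have h2 : (1 : ℝ) ≤ 2 ^ d := one_le_pow₀ (by norm_num)
  have e2 : (2 : ℝ) ^ d * (d : ℝ) ^ n / (n.factorial : ℝ) * (1 / (N : ℝ) ^ n) = 2 ^ d * C := by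
    rw [hC, mul_pow, one_div_pow]; ring
  rw [e2]
  exact le_mul_of_one_le_left hC0 h2

end
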